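/- Let G=(V,E) be a contextuality scenario such that the common intersection ⋂_{e∈E} e is nonempty and e' ∩ e'' = ⋂_{e∈E} e for all distinct edges e', e'' ∈ E. Then G is dilating: every positive operator representation of G, on any complex Hilbert space, dilates to a projective representation of G. -/

import Mathlib

noncomputable section

structure HilbertC where
  carrier : Type
  [normed : NormedAddCommGroup carrier]
  [ips : InnerProductSpace ℂ carrier]
  [complete : CompleteSpace carrier]

attribute [instance] HilbertC.normed HilbertC.ips HilbertC.complete

/-- A positive operator representation of the hypergraph with edge set `E`. -/
def IsPOR {V : Type} [Fintype V] (E : Finset (Finset V)) {H : Type}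
    [NormedAddCommGroup H] [InnerProductSpace ℂ H] [CompleteSpace H]
    (A : V → H →L[ℂ] H) : Prop :=
  (∀ x, (A x).IsPositive) ∧ ∀ e ∈ E, ∑ x ∈ e, A x = 1

/-- A projective representation of the hypergraph with edge set `E`. -/
def IsPR {V : Type} [Fintype V] (E : Finset (Finset V)) {H : Type}
    [NormedAddCommGroup H] [InnerProductSpace ℂ H] [CompleteSpace H]
    (A : V → H →L[ℂ] H) : Prop :=
  (∀ x, IsSelfAdjoint (A x) ∧ IsIdempotentElem (A x)) ∧ ∀ e ∈ E, ∑ x ∈ e, A x = 1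

/-- The POR `A` dilates to a projective representation. -/
def DilatesToPR {V : Type} [Fintype V] (E : Finset (Finset V)) {H : Type}
    [NormedAddCommGroup H] [InnerProductSpace ℂ H] [CompleteSpace H]
    (A : V → H →L[ℂ] H) : Prop :=
  ∃ (K : HilbertC) (B : V → K.carrier →L[ℂ] K.carrier) (Vi : H →L[ℂ] K.carrier),
    IsPR E B ∧ Isometry Vi ∧
    ∀ x, A x = (ContinuousLinearMap.adjoint Vi).comp ((B x).comp Vi)

/-- The hypergraph `(V, E)` is dilating. -/
def Dilating (V : Type) [Fintype V] (E : Finset (Finset V)) : Prop :=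
  ∀ (H : HilbertC) (A : V → H.carrier →L[ℂ] H.carrier), IsPOR E A → DilatesToPR E A

section SwapReflection

variable {H K : Type} [NormedAddCommGroup H] [InnerProductSpace ℂ H]
  [NormedAddCommGroup K] [InnerProductSpace ℂ K] [CompleteSpace K]

/-- Two operators with the same Gram form and orthogonal ranges are exchanged by a self-adjoint
unitary which fixes every vector orthogonal to both ranges. -/
theorem exists_selfAdjoint_involution_swap (S T : H →L[ℂ] K)
    (hST : ∀ h h', inner ℂ (S h) (S h') = inner ℂ (T h) (T h'))
    (hperp : ∀ h h', inner ℂ (S h) (T h') = 0) :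
    ∃ W : K →L[ℂ] K, IsSelfAdjoint W ∧ W * W = 1 ∧ (∀ h, W (S h) = T h) ∧
      ∀ k, (∀ h, inner ℂ (S h) k = 0 ∧ inner ℂ (T h) k = 0) → W k = k := by
  let R : Submodule ℂ K := (S - T).toLinearMap.range
  let W : K →L[ℂ] K := Rᗮ.reflection.toContinuousLinearEquiv.toContinuousLinearMap
  have hW (k : K) : W k = Rᗮ.reflection k := rfl
  have hfix (k : K) (hk : ∀ h, inner ℂ (S h) k = inner ℂ (T h) k) : W k = k := by
    rw [hW]
    apply Submodule.reflection_mem_subspace_eq_self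
    rw [Submodule.mem_orthogonal]
    rintro _ ⟨h, rfl⟩
    simp [inner_sub_left, hk h]
  have hTS (h h' : H) : inner ℂ (T h) (S h') = 0 := by
    rw [← inner_conj_symm, hperp, map_zero]
  refine ⟨W, ?_, ?_, fun h => ?_, fun k hk => hfix k fun h => by rw [(hk h).1, (hk h).2]⟩
  · rw [ContinuousLinearMap.isSelfAdjoint_iff_isSymmetric]
    intro x y
    have := Rᗮ.reflection.inner_map_map x (Rᗮ.reflection y)
    rw [Submodule.reflection_reflection] at this
    exact this
  · ext k
    exact Submodule.reflection_reflection _ k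
  · have hadd : W (S h) + W (T h) = S h + T h := by
      rw [← map_add]
      refine hfix _ fun h' => ?_
      rw [inner_add_right, inner_add_right, hperp, hTS, hST, add_zero, zero_add]
    have hsub : W (S h) - W (T h) = -(S h - T h) := by
      rw [← map_sub, hW]
      apply Submodule.reflection_mem_subspace_orthogonalComplement_eq_neg
      exact Submodule.le_orthogonal_orthogonal R ⟨h, rfl⟩
    have htwo : (2 : ℂ) • W (S h) = (2 : ℂ) • T h := by
      rw [two_smul, two_smul]
      calc W (S h) + W (S h) = (W (S h) + W (T h)) + (W (S h) - W (T h)) := by abel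
        _ = T h + T h := by rw [hadd, hsub]; abel
    exact smul_right_injective K (two_ne_zero (α := ℂ)) htwo

end SwapReflection

section Slots

variable {ι H : Type} [DecidableEq ι] [NormedAddCommGroup H] [InnerProductSpace ℂ H]

/-- The projection of a finite power of `H` onto the coordinates in `s`. -/
def coordProj (H : Type) [NormedAddCommGroup H] [InnerProductSpace ℂ H] (s : Finset ι) :
    PiLp 2 (fun _ : ι => H) →L[ℂ] PiLp 2 (fun _ : ι => H) :=
  (PiLp.continuousLinearEquiv 2 ℂ (fun _ : ι => H)).symm.toContinuousLinearMap ∘L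
    ContinuousLinearMap.pi fun i =>
      if i ∈ s then PiLp.proj (𝕜 := ℂ) 2 (fun _ : ι => H) i else 0

/-- The map into a finite power of `H` with components `D i` for `i ∈ s` and `0` elsewhere. -/
def slotMap (D : ι → H →L[ℂ] H) (s : Finset ι) : H →L[ℂ] PiLp 2 (fun _ : ι => H) :=
  (PiLp.continuousLinearEquiv 2 ℂ (fun _ : ι => H)).symm.toContinuousLinearMap ∘L
    ContinuousLinearMap.pi fun i => if i ∈ s then D i else 0

theorem coordProj_apply (s : Finset ι) (k : PiLp 2 (fun _ : ι => H)) (i : ι) :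
    coordProj H s k i = if i ∈ s then k i else 0 := by
  by_cases h : i ∈ s <;> simp [coordProj, h]

theorem slotMap_apply (D : ι → H →L[ℂ] H) (s : Finset ι) (h : H) (i : ι) :
    slotMap D s h i = if i ∈ s then D i h else 0 := by
  by_cases hi : i ∈ s <;> simp [slotMap, hi]

theorem coordProj_slotMap (D : ι → H →L[ℂ] H) (s t : Finset ι) (h : H) :
    coordProj H s (slotMap D t h) = slotMap D (s ∩ t) h := by
  ext i
  simp only [coordProj_apply, slotMap_apply, Finset.mem_inter, ite_and]

theorem slotMap_union (D : ι → H →L[ℂ] H) {s t : Finset ι} (hst : Disjoint s t) (h : H) :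
    slotMap D (s ∪ t) h = slotMap D s h + slotMap D t h := by
  ext i
  have : i ∈ s → i ∉ t := fun h => Finset.disjoint_left.mp hst h
  by_cases hs : i ∈ s <;> by_cases ht : i ∈ t <;> simp_all [slotMap_apply]

theorem coordProj_idem (s : Finset ι) : IsIdempotentElem (coordProj H s) := by
  ext k i
  by_cases h : i ∈ s <;> simp [coordProj_apply, h]

theorem sum_coordProj_fiber [Fintype ι] {κ : Type} [DecidableEq κ] (c : ι → κ) (e : Finset κ)
    (hc : ∀ i, c i ∈ e) :
    ∑ x ∈ e, coordProj H (Finset.univ.filter fun i => c i = x) = 1 := by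
  ext k i
  simp [coordProj_apply, hc]

variable [Fintype ι] [CompleteSpace H]

theorem coordProj_isSelfAdjoint (s : Finset ι) : IsSelfAdjoint (coordProj H s) := by
  rw [ContinuousLinearMap.isSelfAdjoint_iff_isSymmetric]
  intro x y
  simp only [ContinuousLinearMap.coe_coe, PiLp.inner_apply, coordProj_apply]
  refine Finset.sum_congr rfl fun i _ => ?_
  split_ifs <;> simp

theorem inner_slotMap_slotMap (D : ι → H →L[ℂ] H) (s t : Finset ι) (h h' : H) :
    inner ℂ (slotMap D s h) (slotMap D t h') =
      ∑ i ∈ s ∩ t, inner ℂ h ((star (D i) * D i) h') := by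
  have (i : ι) : inner ℂ h ((star (D i) * D i) h') = inner ℂ (D i h) (D i h') :=
    ContinuousLinearMap.adjoint_inner_right (D i) h (D i h')
  simp only [this, PiLp.inner_apply, slotMap_apply]
  rw [← Finset.sum_subset (Finset.subset_univ (s ∩ t))]
  · refine Finset.sum_congr rfl fun i hi => ?_
    rw [Finset.mem_inter] at hi
    simp [hi.1, hi.2]
  · intro i _ hi
    by_cases hs : i ∈ s <;> by_cases ht : i ∈ t <;> simp_all

end Slots

section Dilation

theorem isometry_of_compression_sum_eq_one {V H K : Type} [NormedAddCommGroup H]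
    [InnerProductSpace ℂ H] [CompleteSpace H] [NormedAddCommGroup K]
    [InnerProductSpace ℂ K] [CompleteSpace K] (A : V → H →L[ℂ] H) (B : V → K →L[ℂ] K)
    (U : H →L[ℂ] K) (e : Finset V) (hA : ∑ x ∈ e, A x = 1) (hB : ∑ x ∈ e, B x = 1)
    (h : ∀ x ∈ e, A x = (ContinuousLinearMap.adjoint U).comp ((B x).comp U)) : Isometry U := by
  rw [ContinuousLinearMap.isometry_iff_adjoint_comp_self, ← hA, Finset.sum_congr rfl h]
  refine ContinuousLinearMap.ext fun k => ?_
  have := congrArg (fun T : K →L[ℂ] K => T (U k)) hB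
  simp only [sum_apply, one_apply_eq_self] at this
  simp only [sum_apply, ContinuousLinearMap.comp_apply, ← map_sum, this]

variable {V H : Type} [Fintype V] [DecidableEq V] [NormedAddCommGroup H] [InnerProductSpace ℂ H]
  [CompleteSpace H]

/-- Dilation of a single edge `e` with kernel `C`, where on the kernel the projections are the
coordinate ones, independently of `e`. -/
theorem exists_edge_dilation (D : Option V → H →L[ℂ] H) (C e : Finset V) (hCe : C ⊆ e)
    {d : V} (hde : d ∈ e) (hdC : d ∉ C)
    (hD : star (D none) * D none = ∑ x ∈ e \ C, star (D (some x)) * D (some x)) :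
    ∃ B : V → PiLp 2 (fun _ : Option V => H) →L[ℂ] PiLp 2 (fun _ : Option V => H),
      (∀ x, IsSelfAdjoint (B x) ∧ IsIdempotentElem (B x)) ∧ ∑ x ∈ e, B x = 1 ∧
      (∀ x ∈ C, B x = coordProj H {some x}) ∧
      ∀ x ∈ e, star (D (some x)) * D (some x) =
        (ContinuousLinearMap.adjoint (slotMap D C.insertNone)).comp
          ((B x).comp (slotMap D C.insertNone)) := by
  obtain ⟨W, hWsa, hWW, hWswap, hWfix⟩ := exists_selfAdjoint_involution_swap
    (slotMap D {none}) (slotMap D ((e \ C).map Function.Embedding.some))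
    (fun h h' => by
      simp only [inner_slotMap_slotMap, Finset.inter_self, Finset.sum_singleton, hD,
        sum_apply, inner_sum, Finset.sum_map]
      rfl)
    (fun h h' => by simp [inner_slotMap_slotMap])
  let c : Option V → V := fun o => o.elim d fun x => if x ∈ e then x else d
  let P : V → PiLp 2 (fun _ : Option V => H) →L[ℂ] PiLp 2 (fun _ : Option V => H) :=
    fun x => coordProj H (Finset.univ.filter fun i => c i = x)
  have hce (o : Option V) : c o ∈ e := by
    cases o with
    | none => exact hde
    | some x => by_cases hx : x ∈ e <;> simp [c, hx, hde]
  have hWcore (s : Finset V) (hs : s ⊆ C) (k : PiLp 2 (fun _ : Option V => H)) :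
      W (coordProj H (s.map Function.Embedding.some) k) =
        coordProj H (s.map Function.Embedding.some) k := by
    refine hWfix _ fun h => ?_
    have hsymm (t : Finset (Option V)) : inner ℂ (slotMap D t h)
        (coordProj H (s.map Function.Embedding.some) k) =
        inner ℂ (slotMap D (s.map Function.Embedding.some ∩ t) h) k := by
      rw [← coordProj_slotMap]
      exact ((ContinuousLinearMap.isSelfAdjoint_iff_isSymmetric.mp
        (coordProj_isSelfAdjoint (s.map Function.Embedding.some))) _ k).symm
    have hempty : slotMap D ∅ h = 0 := by ext i; simp [slotMap_apply]
    constructor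
    · rw [hsymm, show s.map Function.Embedding.some ∩ {none} = ∅ by ext (_ | x) <;> simp,
        hempty, inner_zero_left]
    · rw [hsymm, show s.map Function.Embedding.some ∩ (e \ C).map Function.Embedding.some = ∅ by
        ext (_ | x)
        · simp
        · simpa using fun hx _ => hs hx, hempty, inner_zero_left]
  have hWV (h : H) : W (slotMap D C.insertNone h) = slotMap D (e.map Function.Embedding.some) h := by
    have h1 : C.insertNone = {none} ∪ C.map Function.Embedding.some := by ext (_ | x) <;> simp
    have h2 : e.map Function.Embedding.some =
        (e \ C).map Function.Embedding.some ∪ C.map Function.Embedding.some := by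
      rw [← Finset.map_union, Finset.sdiff_union_of_subset hCe]
    have h3 : W (slotMap D (C.map Function.Embedding.some) h) =
        slotMap D (C.map Function.Embedding.some) h := by
      have := hWcore C subset_rfl (slotMap D (C.map Function.Embedding.some) h)
      rwa [coordProj_slotMap, Finset.inter_self] at this
    rw [h1, h2, slotMap_union, slotMap_union, map_add, hWswap, h3]
    · rw [Finset.disjoint_map]; exact Finset.sdiff_disjoint
    · simp
  refine ⟨fun x => W * P x * W, fun x => ⟨?_, ?_⟩, ?_, fun x hx => ?_, fun x hx => ?_⟩
  · have := (coordProj_isSelfAdjoint (H := H) (Finset.univ.filter fun i => c i = x)).conjugate W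
    rwa [hWsa.star_eq] at this
  · have hP : P x * P x = P x := coordProj_idem _
    calc W * P x * W * (W * P x * W) = W * P x * (W * W) * P x * W := by simp only [mul_assoc]
      _ = W * (P x * P x) * W := by rw [hWW, mul_one]; simp only [mul_assoc]
      _ = W * P x * W := by rw [hP]
  · rw [← Finset.sum_mul, ← Finset.mul_sum, sum_coordProj_fiber c e hce, mul_one, hWW]
  · have hfib : (Finset.univ.filter fun i => c i = x) = {some x} := by
      have hdx : d ≠ x := fun h => hdC (h ▸ hx)
      ext (_ | y)
      · simp [c, hdx]
      · by_cases hy : y ∈ e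
        · simp [c, hy]
        · have : y ≠ x := fun h => hy (h ▸ hCe hx)
          simp [c, hy, hdx, this]
    have hleft : W * coordProj H {some x} = coordProj H {some x} := by
      refine ContinuousLinearMap.ext fun k => ?_
      simpa using hWcore {x} (by simpa using hx) k
    have hright : coordProj H {some x} * W = coordProj H {some x} := by
      have := congrArg star hleft
      rwa [star_mul, hWsa.star_eq, (coordProj_isSelfAdjoint _).star_eq] at this
    simp only [P, hfib, hleft, hright]
  · have hfib : (Finset.univ.filter fun i => c i = x) ∩ e.map Function.Embedding.some =
        {some x} := by
      ext (_ | y)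
      · simp
      · by_cases hy : y ∈ e
        · simp [c, hy]
        · have : y ≠ x := fun h => hy (h ▸ hx)
          simp [hy, this]
    refine ContinuousLinearMap.ext fun h => ext_inner_left ℂ fun h' => ?_
    have hWsymm := ContinuousLinearMap.isSelfAdjoint_iff_isSymmetric.mp hWsa
    calc inner ℂ h' ((star (D (some x)) * D (some x)) h)
        = inner ℂ (slotMap D (e.map Function.Embedding.some) h')
            (P x (slotMap D (e.map Function.Embedding.some) h)) := by
          rw [coordProj_slotMap, hfib, inner_slotMap_slotMap,
            Finset.inter_singleton_of_mem (by simpa using hx), Finset.sum_singleton]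
      _ = inner ℂ (slotMap D C.insertNone h') (W (P x (W (slotMap D C.insertNone h)))) := by
          rw [← hWV, ← hWV]
          exact hWsymm _ _
      _ = _ := (ContinuousLinearMap.adjoint_inner_right _ _ _).symm

/-- A single POVM dilates to a projection-valued one, extended by zero off its support. -/
theorem exists_povm_dilation (D : V → H →L[ℂ] H) (C : Finset V) (hC : C.Nonempty)
    (hD : ∀ x ∉ C, star (D x) * D x = 0) :
    ∃ B : V → PiLp 2 (fun _ : V => H) →L[ℂ] PiLp 2 (fun _ : V => H),
      (∀ x, IsSelfAdjoint (B x) ∧ IsIdempotentElem (B x)) ∧ (∀ x ∉ C, B x = 0) ∧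
      ∑ x ∈ C, B x = 1 ∧
      ∀ x, star (D x) * D x =
        (ContinuousLinearMap.adjoint (slotMap D C)).comp ((B x).comp (slotMap D C)) := by
  obtain ⟨d, hd⟩ := hC
  let c : V → V := fun x => if x ∈ C then x else d
  have hcC (x : V) : c x ∈ C := by by_cases hx : x ∈ C <;> simp [c, hx, hd]
  refine ⟨fun x => coordProj H (Finset.univ.filter fun i => c i = x),
    fun x => ⟨coordProj_isSelfAdjoint _, coordProj_idem _⟩, fun x hx => ?_,
    sum_coordProj_fiber c C hcC, fun x => ?_⟩
  · ext k i
    have : c i ≠ x := fun h => hx (h ▸ hcC i)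
    simp [coordProj_apply, this]
  · refine ContinuousLinearMap.ext fun h => ext_inner_left ℂ fun h' => ?_
    rw [ContinuousLinearMap.comp_apply, ContinuousLinearMap.adjoint_inner_right]
    simp only [ContinuousLinearMap.comp_apply, coordProj_slotMap, inner_slotMap_slotMap]
    by_cases hx : x ∈ C
    · have : C ∩ ((Finset.univ.filter fun i => c i = x) ∩ C) = {x} := by
        ext y
        by_cases hy : y ∈ C
        · simp [c, hy]
        · have : y ≠ x := fun h => hy (h ▸ hx)
          simp [hy, this]
      rw [this, Finset.sum_singleton]
    · have : C ∩ ((Finset.univ.filter fun i => c i = x) ∩ C) = ∅ := by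
        ext y
        have : c y ≠ x := fun h => hx (h ▸ hcC y)
        simp [this]
      rw [this, hD x hx]
      simp

end Dilation

theorem stmt0 (V : Type) [Fintype V] [DecidableEq V]
    (E : Finset (Finset V)) (hEne : E.Nonempty) (hene : ∀ e ∈ E, e.Nonempty)
    (hcover : ∀ x : V, ∃ e ∈ E, x ∈ e)
    (hintne : (E.inf id).Nonempty)
    (hint : ∀ e ∈ E, ∀ f ∈ E, e ≠ f → e ∩ f = E.inf id) :
    Dilating V E := by
  rintro ⟨H⟩ A ⟨hpos, hsum⟩
  have hsqrt (T : H →L[ℂ] H) (hT : T.IsPositive) : ∃ R : H →L[ℂ] H, T = star R * R :=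
    CStarAlgebra.nonneg_iff_eq_star_mul_self.mp
      ((ContinuousLinearMap.nonneg_iff_isPositive T).mpr hT)
  set C : Finset V := E.inf id
  have hCe : ∀ e ∈ E, C ⊆ e := fun e he => Finset.inf_le (f := id) he
  have hsplit : ∀ e ∈ E, ∑ x ∈ e \ C, A x = 1 - ∑ x ∈ C, A x := fun e he => by
    rw [← hsum e he, ← Finset.sum_sdiff (hCe e he), add_sub_cancel_right]
  choose R hR using fun x => hsqrt (A x) (hpos x)
  by_cases hCE : C ∈ E
  · have hzero : ∀ x ∉ C, A x = 0 := fun x hx => by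
      obtain ⟨e, he, hxe⟩ := hcover x
      have h0 : ∑ x ∈ e \ C, A x = 0 := by rw [hsplit e he, hsum C hCE, sub_self]
      rw [Finset.sum_eq_zero_iff_of_nonneg fun y _ =>
        (ContinuousLinearMap.nonneg_iff_isPositive _).mpr (hpos y)] at h0
      exact h0 x (Finset.mem_sdiff.mpr ⟨hxe, hx⟩)
    obtain ⟨B, hproj, hB0, hB1, hdil⟩ :=
      exists_povm_dilation R C hintne fun x hx => by rw [← hR, hzero x hx]
    refine ⟨⟨PiLp 2 fun _ : V => H⟩, B, slotMap R C, ⟨hproj, fun e he => ?_⟩, ?_,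
      fun x => (hR x).trans (hdil x)⟩
    · rw [← hB1]
      exact (Finset.sum_subset (hCe e he) fun x _ hx => hB0 x hx).symm
    · exact isometry_of_compression_sum_eq_one A B _ C (hsum C hCE) hB1
        fun x _ => (hR x).trans (hdil x)
  · obtain ⟨e₀, he₀⟩ := hEne
    obtain ⟨R₀, hR₀⟩ : ∃ R₀ : H →L[ℂ] H, 1 - ∑ x ∈ C, A x = star R₀ * R₀ := by
      rw [← hsplit e₀ he₀]
      exact hsqrt _ (ContinuousLinearMap.isPositive_sum _ fun x _ => hpos x)
    let D : Option V → H →L[ℂ] H := fun o => o.elim R₀ R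
    have hD (e : E) : star (D none) * D none =
        ∑ x ∈ e.1 \ C, star (D (some x)) * D (some x) := by
      change star R₀ * R₀ = ∑ x ∈ e.1 \ C, star (R x) * R x
      simp only [← hR, ← hR₀, hsplit e e.2]
    choose d hde hdC using fun e : E => Finset.exists_of_ssubset
      ((hCe e e.2).ssubset_of_ne fun h => hCE (h ▸ e.2))
    choose B hproj hB1 hBC hdil using fun e : E =>
      exists_edge_dilation D C e (hCe e e.2) (hde e) (hdC e) (hD e)
    choose edge hedgeE hedge_mem using hcover
    have hBeq (e : E) (x : V) (hx : x ∈ e.1) : B ⟨edge x, hedgeE x⟩ x = B e x := by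
      by_cases hxC : x ∈ C
      · rw [hBC _ x hxC, hBC _ x hxC]
      · congr 1
        by_contra hne
        apply hxC
        rw [← hint (edge x) (hedgeE x) e e.2 fun h => hne (by simp [h])]
        exact Finset.mem_inter.mpr ⟨hedge_mem x, hx⟩
    have hsum1 : ∀ e ∈ E, ∑ x ∈ e, B ⟨edge x, hedgeE x⟩ x = 1 := fun e he => by
      rw [← hB1 ⟨e, he⟩]
      exact Finset.sum_congr rfl fun x hx => hBeq ⟨e, he⟩ x hx
    have hcomp (x : V) := (hR x).trans (hdil ⟨edge x, hedgeE x⟩ x (hedge_mem x))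
    exact ⟨⟨PiLp 2 fun _ : Option V => H⟩, fun x => B ⟨edge x, hedgeE x⟩ x,
      slotMap D C.insertNone, ⟨fun x => hproj _ x, hsum1⟩,
      isometry_of_compression_sum_eq_one A _ _ e₀ (hsum e₀ he₀) (hsum1 e₀ he₀)
        fun x _ => hcomp x, hcomp⟩
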